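/- arXiv:1107.5222 — 7 statements merged into one kernel-verified Lean document; each statement's English description precedes it below -/
import Mathlib

section
/- (Reverse generalized Young inequality.) Let a ≥ 0 and b > 0 be real numbers, let 0 < α ≤ 1, and let 0 < p < 1 and q be real numbers with 1/p + 1/q = 1 (so q < 0). Then a^α · b^α ≥ a^(pα)/p + b^(qα)/q, with equality if and only if a^p = b^q. -/
/-- The equality case of Bernoulli's inequality for exponents in `(0, 1)`. -/
theorem Real.rpow_eq_one_add_mul_sub_one_iff {r p : ℝ} (hr : 0 ≤ r) (hp0 : 0 < p) (hp1 : p < 1) :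
    r ^ p = 1 + p * (r - 1) ↔ r = 1 := by
  refine ⟨fun h => ?_, fun h => by simp [h]⟩
  by_contra hne
  have hlt := rpow_one_add_lt_one_add_mul_self (s := r - 1) (by linarith)
    (sub_ne_zero.mpr hne) hp0 hp1
  rw [add_sub_cancel] at hlt
  exact hlt.ne h

theorem generalized_reverse_young (a b α p q : ℝ) (ha : 0 ≤ a) (hb : 0 < b)
    (hα0 : 0 < α) (hα1 : α ≤ 1) (hp0 : 0 < p) (hp1 : p < 1) (hpq : 1 / p + 1 / q = 1) :
    a ^ α * b ^ α ≥ a ^ (p * α) / p + b ^ (q * α) / q ∧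
      (a ^ α * b ^ α = a ^ (p * α) / p + b ^ (q * α) / q ↔ a ^ p = b ^ q) := by
  have hq : q ≠ 0 := by
    rintro rfl
    rw [div_zero, add_zero, div_eq_one_iff_eq hp0.ne'] at hpq
    exact hp1.ne hpq.symm
  have hmul : (q - 1) * p = q := by
    field_simp at hpq
    linarith
  obtain ⟨c, hc, rfl⟩ : ∃ c : ℝ, 0 ≤ c ∧ a = c * b ^ (q - 1) :=
    ⟨a / b ^ (q - 1), by positivity, by field_simp⟩
  have hpow (s : ℝ) : (c * b ^ (q - 1)) ^ s = c ^ s * b ^ ((q - 1) * s) := by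
    rw [Real.mul_rpow hc (by positivity), ← Real.rpow_mul hb.le]
  have hleft : (c * b ^ (q - 1)) ^ α * b ^ α = c ^ α * b ^ (q * α) := by
    rw [hpow, mul_assoc, ← Real.rpow_add hb]
    ring_nf
  have hright : (c * b ^ (q - 1)) ^ (p * α) = (c ^ α) ^ p * b ^ (q * α) := by
    rw [hpow, ← mul_assoc, hmul, ← Real.rpow_mul hc, mul_comm p α]
  have hu : 0 < b ^ (q * α) := Real.rpow_pos_of_pos hb _
  have hr : 0 ≤ c ^ α := Real.rpow_nonneg hc α
  have hone (s : ℝ) (hs : 0 < s) : c ^ s = 1 ↔ c = 1 :=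
    ⟨fun h => Real.rpow_left_injOn hs.ne' hc (zero_le_one' ℝ) (by simpa using h),
      fun h => by simp [h]⟩
  have hiff : (c * b ^ (q - 1)) ^ p = b ^ q ↔ c ^ α = 1 := by
    rw [hpow, hmul, mul_eq_right₀ (Real.rpow_pos_of_pos hb q).ne', hone p hp0, hone α hα0]
  rw [hleft, hright, hiff, ← Real.rpow_eq_one_add_mul_sub_one_iff hr hp0 hp1]
  have hbern := rpow_one_add_le_one_add_mul_self (s := c ^ α - 1) (by linarith) hp0.le hp1.le
  rw [add_sub_cancel] at hbern
  generalize c ^ α = r at *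
  generalize b ^ (q * α) = u at *
  have hdiff : r * u - (r ^ p * u / p + u / q) = u / p * (1 + p * (r - 1) - r ^ p) := by
    rw [div_eq_mul_one_div u q, eq_sub_of_add_eq' hpq]
    field_simp
    ring
  constructor
  · rw [ge_iff_le, ← sub_nonneg, hdiff]
    exact mul_nonneg (by positivity) (sub_nonneg.mpr hbern)
  · rw [← sub_eq_zero, hdiff, mul_eq_zero_iff_left (by positivity), sub_eq_zero, eq_comm]
end

section
/- Let n ≥ 2, let a_1 ≥ 0 and a_2, …, a_n > 0 be real numbers, let 0 < α ≤ 1, and let p_1, …, p_n be real numbers with 0 < p_1 < 1, p_i < 0 for i = 2, …, n, and ∑_{i=1}^n 1/p_i = 1. Then ∏_{i=1}^n a_i^α ≥ ∑_{i=1}^n a_i^(p_i α)/p_i. -/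
/-- **Reverse Young inequality**: if one exponent is positive, all others are negative, and the
reciprocals of the exponents sum to one, then Young's inequality is reversed. -/
theorem Real.rpow_div_add_sum_rpow_div_le_mul_prod {ι : Type*} (s : Finset ι) {x p : ℝ}
    {y q : ι → ℝ} (hx : 0 ≤ x) (hp : 0 < p) (hy : ∀ i ∈ s, 0 < y i) (hq : ∀ i ∈ s, q i < 0)
    (hpq : 1 / p + ∑ i ∈ s, 1 / q i = 1) :
    x ^ p / p + ∑ i ∈ s, y i ^ q i / q i ≤ x * ∏ i ∈ s, y i := by
  have hprod : 0 < ∏ i ∈ s, y i := Finset.prod_pos hy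
  have amgm := Real.geom_mean_le_arith_mean_weighted (Finset.insertNone s)
    (fun o => o.elim p fun i => -p / q i)
    (fun o => o.elim (x * ∏ i ∈ s, y i) fun i => y i ^ q i)
    (by
      rw [Finset.forall_mem_insertNone]
      exact ⟨hp.le, fun i hi => div_nonneg_of_nonpos (neg_nonpos.2 hp.le) (hq i hi).le⟩)
    (by
      have hsum : ∑ i ∈ s, -p / q i = -p * ∑ i ∈ s, 1 / q i := by
        simp only [Finset.mul_sum, mul_one_div]
      simp only [Finset.sum_insertNone, Option.elim_none, Option.elim_some]
      rw [hsum, eq_sub_of_add_eq' hpq]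
      field_simp
      ring)
    (by
      rw [Finset.forall_mem_insertNone]
      exact ⟨mul_nonneg hx hprod.le, fun i hi => Real.rpow_nonneg (hy i hi).le _⟩)
  simp only [Finset.sum_insertNone, Finset.prod_insertNone, Option.elim_none,
    Option.elim_some] at amgm
  have hgeom : ∏ i ∈ s, (y i ^ q i) ^ (-p / q i) = ((∏ i ∈ s, y i) ^ p)⁻¹ := by
    rw [← Real.rpow_neg hprod.le, ← Real.finsetProd_rpow s y fun i hi => (hy i hi).le]
    refine Finset.prod_congr rfl fun i hi => ?_
    rw [← Real.rpow_mul (hy i hi).le, mul_div_cancel₀ _ (hq i hi).ne]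
  have harith : ∑ i ∈ s, -p / q i * y i ^ q i = -(p * ∑ i ∈ s, y i ^ q i / q i) := by
    rw [Finset.mul_sum, ← Finset.sum_neg_distrib]
    exact Finset.sum_congr rfl fun i _ => by ring
  rw [hgeom, harith, Real.mul_rpow hx hprod.le,
    mul_inv_cancel_right₀ (Real.rpow_pos_of_pos hprod p).ne'] at amgm
  rw [← le_sub_iff_add_le, div_le_iff₀ hp]
  linarith

theorem generalized_reverse_young_n_terms (n : ℕ) (hn : 2 ≤ n) (a : Fin n → ℝ) (p : Fin n → ℝ)
    (α : ℝ) (hα0 : 0 < α) (hα1 : α ≤ 1)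
    (ha1 : ∀ i : Fin n, i.val = 0 → 0 ≤ a i)
    (ha2 : ∀ i : Fin n, i.val ≠ 0 → 0 < a i)
    (hp1 : ∀ i : Fin n, i.val = 0 → 0 < p i ∧ p i < 1)
    (hp2 : ∀ i : Fin n, i.val ≠ 0 → p i < 0)
    (hps : ∑ i, 1 / p i = 1) :
    ∏ i, (a i) ^ α ≥ ∑ i, (a i) ^ (p i * α) / p i := by
  obtain ⟨m, rfl⟩ : ∃ m, n = m + 1 := ⟨n - 1, by omega⟩
  have hpow (i : Fin (m + 1)) : a i ^ (p i * α) = (a i ^ α) ^ p i := by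
    have hai : 0 ≤ a i := by
      by_cases hi : i.val = 0
      · exact ha1 i hi
      · exact (ha2 i hi).le
    rw [mul_comm, Real.rpow_mul hai]
  simp only [hpow]
  rw [Fin.sum_univ_succ] at hps ⊢
  rw [Fin.prod_univ_succ]
  exact Real.rpow_div_add_sum_rpow_div_le_mul_prod Finset.univ
    (Real.rpow_nonneg (ha1 0 rfl) α) (hp1 0 rfl).1
    (fun i _ => Real.rpow_pos_of_pos (ha2 i.succ (Nat.succ_ne_zero i)) α)
    (fun i _ => hp2 i.succ (Nat.succ_ne_zero i)) hps
end

section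
/- (Reverse generalized Hölder inequality.) Let n ≥ 1, let x_1, …, x_n be real numbers and y_1, …, y_n be nonzero real numbers, let 0 < α ≤ 1, and let 0 < p < 1 and q be real numbers with 1/p + 1/q = 1 (so q < 0). Then ∑_{i=1}^n |x_i|^α · |y_i|^α ≥ (∑_{i=1}^n |x_i|^(αp))^(1/p) · (∑_{i=1}^n |y_i|^(αq))^(1/q). -/
/-- **Reverse Hölder inequality**: for `0 < p < 1` and `1 / p + 1 / q = 1`, so that `q < 0`. -/
theorem Real.Lp_mul_Lq_le_inner_of_lt_one {ι : Type*} (s : Finset ι) {f g : ι → ℝ} {p q : ℝ}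
    (hp0 : 0 < p) (hp1 : p < 1) (hpq : 1 / p + 1 / q = 1)
    (hf : ∀ i ∈ s, 0 ≤ f i) (hg : ∀ i ∈ s, 0 < g i) :
    (∑ i ∈ s, f i ^ p) ^ (1 / p) * (∑ i ∈ s, g i ^ q) ^ (1 / q) ≤ ∑ i ∈ s, f i * g i := by
  rcases s.eq_empty_or_nonempty with rfl | hs
  · simp [hp0.ne']
  have hq : q < 0 := by
    have := one_lt_one_div hp0 hp1
    exact one_div_neg.1 (by linarith)
  have htriple : Real.HolderTriple 1 (-q) p :=
    ⟨by simp only [one_div] at hpq; rw [inv_one, inv_neg]; linarith, one_pos, neg_pos.2 hq⟩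
  have hA : 0 ≤ ∑ i ∈ s, f i ^ p := Finset.sum_nonneg fun i hi ↦ rpow_nonneg (hf i hi) p
  have hS : 0 ≤ ∑ i ∈ s, f i * g i :=
    Finset.sum_nonneg fun i hi ↦ mul_nonneg (hf i hi) (hg i hi).le
  have hB : 0 < ∑ i ∈ s, g i ^ q := Finset.sum_pos (fun i hi ↦ rpow_pos_of_pos (hg i hi) q) hs
  have holder : ∑ i ∈ s, f i ^ p ≤
      (∑ i ∈ s, f i * g i) ^ p * (∑ i ∈ s, g i ^ q) ^ (p / -q) := by
    convert Real.Lr_rpow_le_Lp_mul_Lq_of_nonneg s htriple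
      (f := fun i ↦ f i * g i) (g := fun i ↦ (g i)⁻¹)
      (fun i hi ↦ mul_nonneg (hf i hi) (hg i hi).le)
      (fun i hi ↦ (inv_pos.2 (hg i hi)).le) using 1
    · exact Finset.sum_congr rfl fun i hi ↦ by rw [mul_inv_cancel_right₀ (hg i hi).ne']
    · simp only [rpow_one, div_one]
      congr 2
      exact Finset.sum_congr rfl fun i hi ↦ by
        rw [inv_rpow (hg i hi).le, rpow_neg (hg i hi).le, inv_inv]
  have hroot := rpow_le_rpow hA holder (one_div_pos.2 hp0).le
  rw [mul_rpow (rpow_nonneg hS p) (rpow_nonneg hB.le _), ← rpow_mul hS, ← rpow_mul hB.le,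
    mul_one_div_cancel hp0.ne', rpow_one,
    show p / -q * (1 / p) = -(1 / q) by have := hq.ne; have := hp0.ne'; field_simp,
    rpow_neg hB.le, ← div_eq_mul_inv] at hroot
  exact (le_div_iff₀ (rpow_pos_of_pos hB _)).1 hroot

theorem generalized_reverse_holder (n : ℕ) (hn : 1 ≤ n) (x y : Fin n → ℝ) (α p q : ℝ)
    (hy : ∀ i, y i ≠ 0)
    (hα0 : 0 < α) (hα1 : α ≤ 1) (hp0 : 0 < p) (hp1 : p < 1) (hpq : 1 / p + 1 / q = 1) :
    ∑ i, |x i| ^ α * |y i| ^ α ≥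
      (∑ i, |x i| ^ (α * p)) ^ (1 / p) * (∑ i, |y i| ^ (α * q)) ^ (1 / q) := by
  simp only [Real.rpow_mul (abs_nonneg _)]
  exact Real.Lp_mul_Lq_le_inner_of_lt_one Finset.univ hp0 hp1 hpq
    (fun i _ ↦ Real.rpow_nonneg (abs_nonneg (x i)) α)
    (fun i _ ↦ Real.rpow_pos_of_pos (abs_pos.2 (hy i)) α)
end

section
/- (Reverse generalized Minkowski inequality.) Let n ≥ 1, let x_1, …, x_n and y_1, …, y_n be real numbers, let 0 < α ≤ 1, and let 0 < p < 1 be real. Then (∑_{i=1}^n (|x_i|^α + |y_i|^α)^p)^(1/p) ≥ (∑_{i=1}^n |x_i|^(αp))^(1/p) + (∑_{i=1}^n |y_i|^(αp))^(1/p). -/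
/-- **Minkowski inequality** for a finite sum of finitely supported real functions. -/
theorem Real.Lp_sum_le {ι κ : Type*} (s : Finset ι) (t : Finset κ) (g : ι → κ → ℝ) {r : ℝ}
    (hr : 1 ≤ r) :
    (∑ j ∈ t, |∑ i ∈ s, g i j| ^ r) ^ (1 / r) ≤ ∑ i ∈ s, (∑ j ∈ t, |g i j| ^ r) ^ (1 / r) := by
  have hr0 : r ≠ 0 := by positivity
  have h := Finset.le_sum_of_subadditive (fun v : κ → ℝ ↦ (∑ j ∈ t, |v j| ^ r) ^ (1 / r))
    (by simp [Real.zero_rpow, hr0]) (fun v w ↦ Real.Lp_add_le t v w hr) s g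
  simpa only [Finset.sum_apply] using h

/-- **Reverse Minkowski inequality**: for `0 < p ≤ 1` the `ℓᵖ` functional is superadditive on
nonnegative functions. -/
theorem Real.add_Lp_le_Lp_add_of_nonneg {ι : Type*} (s : Finset ι) {a b : ι → ℝ} {p : ℝ}
    (ha : ∀ i, 0 ≤ a i) (hb : ∀ i, 0 ≤ b i) (hp0 : 0 < p) (hp1 : p ≤ 1) :
    (∑ i ∈ s, a i ^ p) ^ (1 / p) + (∑ i ∈ s, b i ^ p) ^ (1 / p) ≤
      (∑ i ∈ s, (a i + b i) ^ p) ^ (1 / p) := by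
  have hap : ∀ i, 0 ≤ a i ^ p := fun i ↦ Real.rpow_nonneg (ha i) p
  have hbp : ∀ i, 0 ≤ b i ^ p := fun i ↦ Real.rpow_nonneg (hb i) p
  have hA := Finset.sum_nonneg fun i (_ : i ∈ s) ↦ hap i
  have hB := Finset.sum_nonneg fun i (_ : i ∈ s) ↦ hbp i
  have h := Real.Lp_sum_le s Finset.univ (fun i ↦ ![a i ^ p, b i ^ p]) (one_le_one_div hp0 hp1)
  simp only [Fin.sum_univ_two, Matrix.cons_val_zero, Matrix.cons_val_one, one_div_one_div,
    abs_of_nonneg hA, abs_of_nonneg hB, abs_of_nonneg (hap _), abs_of_nonneg (hbp _)] at h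
  simp only [one_div, Real.rpow_rpow_inv (ha _) hp0.ne', Real.rpow_rpow_inv (hb _) hp0.ne'] at h ⊢
  rwa [Real.le_rpow_inv_iff_of_pos (by positivity)
    (Finset.sum_nonneg fun i _ ↦ Real.rpow_nonneg (add_nonneg (ha i) (hb i)) p) hp0]

theorem generalized_reverse_minkowski (n : ℕ) (hn : 1 ≤ n) (x y : Fin n → ℝ) (α p : ℝ)
    (hα0 : 0 < α) (hα1 : α ≤ 1) (hp0 : 0 < p) (hp1 : p < 1) :
    (∑ i, (|x i| ^ α + |y i| ^ α) ^ p) ^ (1 / p) ≥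
      (∑ i, |x i| ^ (α * p)) ^ (1 / p) + (∑ i, |y i| ^ (α * p)) ^ (1 / p) := by
  simp only [Real.rpow_mul (abs_nonneg _)]
  exact Real.add_Lp_le_Lp_add_of_nonneg Finset.univ (fun i ↦ by positivity)
    (fun i ↦ by positivity) hp0 hp1.le
end

section
/- (Reverse generalized Hölder inequality for m families.) Let n ≥ 1 and m ≥ 2, let x_{ij} (1 ≤ i ≤ n, 1 ≤ j ≤ m) be real numbers with x_{ij} ≠ 0 for all i and all j ≥ 2, let 0 < α ≤ 1, and let p_1, …, p_m be real numbers with 0 < p_1 < 1, p_j < 0 for j = 2, …, m, and ∑_{j=1}^m 1/p_j = 1. Then ∑_{i=1}^n ∏_{j=1}^m |x_{ij}|^α ≥ ∏_{j=1}^m (∑_{i=1}^n |x_{ij}|^(α p_j))^(1/p_j). -/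
open Finset in
/-- Reverse weighted AM-GM inequality: one nonnegative weight, the other weights nonpositive. -/
theorem weighted_arith_mean_le_geom_mean_of_nonpos {k : ℕ} (w₀ b₀ : ℝ) (w b : Fin k → ℝ)
    (hw₀ : 0 < w₀) (hw : ∀ j, w j ≤ 0) (hsum : w₀ + ∑ j, w j = 1)
    (hb₀ : 0 ≤ b₀) (hb : ∀ j, 0 < b j) :
    w₀ * b₀ + ∑ j, w j * b j ≤ b₀ ^ w₀ * ∏ j, b j ^ w j := by
  rcases hb₀.eq_or_lt with rfl | hb₀
  · rw [Real.zero_rpow hw₀.ne', mul_zero, zero_mul, zero_add]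
    exact sum_nonpos fun j _ => mul_nonpos_of_nonpos_of_nonneg (hw j) (hb j).le
  set Q := ∏ j, b j ^ w j with hQ
  have hQ_pos : 0 < Q := prod_pos fun j _ => Real.rpow_pos_of_pos (hb j) _
  have key := Real.geom_mean_le_arith_mean_weighted (univ : Finset (Fin (k + 1)))
    (Fin.cons (1 / w₀) fun j => -w j / w₀) (Fin.cons (b₀ ^ w₀ * Q) b)
    (by
      intro j _
      refine Fin.cases ?_ (fun j => ?_) j
      · simpa using hw₀.le
      · simpa using div_nonneg (neg_nonneg.2 (hw j)) hw₀.le)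
    (by
      rw [Fin.sum_univ_succ]
      simp only [Fin.cons_zero, Fin.cons_succ]
      rw [← sum_div, sum_neg_distrib, ← add_div, div_eq_one_iff_eq hw₀.ne']
      linarith)
    (by
      intro j _
      refine Fin.cases ?_ (fun j => ?_) j
      · simpa using by positivity
      · simpa using (hb j).le)
  simp only [Fin.prod_univ_succ, Fin.sum_univ_succ, Fin.cons_zero, Fin.cons_succ] at key
  have hprod : ∏ j, b j ^ (-w j / w₀) = (Q ^ (1 / w₀))⁻¹ := by
    rw [hQ, ← Real.finsetProd_rpow _ _ fun j _ => (Real.rpow_pos_of_pos (hb j) _).le,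
      ← prod_inv_distrib]
    refine prod_congr rfl fun j _ => ?_
    rw [← Real.rpow_mul (hb j).le, ← Real.rpow_neg (hb j).le]
    congr 1
    ring
  have hroot : (b₀ ^ w₀) ^ (1 / w₀) = b₀ := by
    rw [← Real.rpow_mul hb₀.le, mul_one_div_cancel hw₀.ne', Real.rpow_one]
  rw [Real.mul_rpow (by positivity) hQ_pos.le, hprod, hroot,
    mul_inv_cancel_right₀ (Real.rpow_pos_of_pos hQ_pos _).ne'] at key
  have hlin : 1 / w₀ * (b₀ ^ w₀ * Q) + ∑ j, -w j / w₀ * b j =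
      (b₀ ^ w₀ * Q - ∑ j, w j * b j) / w₀ := by
    rw [sub_div, sum_div, sub_eq_add_neg, ← sum_neg_distrib]
    congr 1
    · ring
    · exact sum_congr rfl fun j _ => by ring
  rw [hlin, le_div_iff₀ hw₀] at key
  linarith

open Finset in
/-- Reverse Hölder inequality in weighted form, one positive exponent and the others nonpositive. -/
theorem prod_sum_rpow_le_sum_prod_rpow {ι : Type*} [Fintype ι] [Nonempty ι] {k : ℕ}
    (w₀ : ℝ) (w : Fin k → ℝ) (a₀ : ι → ℝ) (a : ι → Fin k → ℝ)
    (hw₀ : 0 < w₀) (hw : ∀ j, w j ≤ 0) (hsum : w₀ + ∑ j, w j = 1)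
    (ha₀ : ∀ i, 0 ≤ a₀ i) (ha : ∀ i j, 0 < a i j) :
    (∑ i, a₀ i) ^ w₀ * ∏ j, (∑ i, a i j) ^ w j ≤ ∑ i, a₀ i ^ w₀ * ∏ j, a i j ^ w j := by
  have hS : ∀ j, 0 < ∑ i, a i j := fun j => sum_pos (fun i _ => ha i j) univ_nonempty
  rcases (sum_nonneg fun i _ => ha₀ i : 0 ≤ ∑ i, a₀ i).eq_or_lt with h0 | hS₀
  · rw [← h0, Real.zero_rpow hw₀.ne', zero_mul]
    exact sum_nonneg fun i _ => mul_nonneg (Real.rpow_nonneg (ha₀ i) _)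
      (prod_nonneg fun j _ => Real.rpow_nonneg (ha i j).le _)
  have hT : 0 < (∑ i, a₀ i) ^ w₀ * ∏ j, (∑ i, a i j) ^ w j :=
    mul_pos (Real.rpow_pos_of_pos hS₀ _) (prod_pos fun j _ => Real.rpow_pos_of_pos (hS j) _)
  rw [← one_le_div hT, sum_div]
  have hterm : ∀ i, w₀ * (a₀ i / ∑ i, a₀ i) + ∑ j, w j * (a i j / ∑ i, a i j) ≤
      (a₀ i ^ w₀ * ∏ j, a i j ^ w j) / ((∑ i, a₀ i) ^ w₀ * ∏ j, (∑ i, a i j) ^ w j) := by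
    intro i
    refine (weighted_arith_mean_le_geom_mean_of_nonpos w₀ _ w _ hw₀ hw hsum
      (div_nonneg (ha₀ i) hS₀.le) fun j => div_pos (ha i j) (hS j)).trans_eq ?_
    rw [mul_div_mul_comm, ← prod_div_distrib, Real.div_rpow (ha₀ i) hS₀.le]
    congr 1
    exact prod_congr rfl fun j _ => Real.div_rpow (ha i j).le (hS j).le _
  refine le_trans (le_of_eq ?_) (sum_le_sum fun i _ => hterm i)
  rw [sum_add_distrib, sum_comm, ← mul_sum, ← sum_div, div_self hS₀.ne', mul_one, ← hsum]
  congr 1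
  refine sum_congr rfl fun j _ => ?_
  rw [← mul_sum, ← sum_div, div_self (hS j).ne', mul_one]

theorem generalized_reverse_holder_m_families (n m : ℕ) (hn : 1 ≤ n) (hm : 2 ≤ m)
    (x : Fin n → Fin m → ℝ) (α : ℝ) (p : Fin m → ℝ)
    (hx : ∀ i, ∀ j : Fin m, j.val ≠ 0 → x i j ≠ 0)
    (hα0 : 0 < α) (hα1 : α ≤ 1)
    (hp1 : ∀ j : Fin m, j.val = 0 → 0 < p j ∧ p j < 1)
    (hp2 : ∀ j : Fin m, j.val ≠ 0 → p j < 0)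
    (hps : ∑ j, 1 / p j = 1) :
    ∑ i, ∏ j, |x i j| ^ α ≥ ∏ j, (∑ i, |x i j| ^ (α * p j)) ^ (1 / p j) := by
  obtain ⟨k, rfl⟩ : ∃ k, m = k + 1 := ⟨m - 1, by omega⟩
  have : Nonempty (Fin n) := ⟨⟨0, hn⟩⟩
  have hsucc : ∀ j : Fin k, (j.succ : Fin (k + 1)).val ≠ 0 := fun j => by simp
  have hp : ∀ j, p j ≠ 0 := fun j => by
    by_cases hj : j.val = 0
    · exact (hp1 j hj).1.ne'
    · exact (hp2 j hj).ne
  have hpow : ∀ i j, (|x i j| ^ (α * p j)) ^ (1 / p j) = |x i j| ^ α := fun i j => by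
    rw [← Real.rpow_mul (abs_nonneg _), mul_assoc, mul_one_div_cancel (hp j), mul_one]
  rw [Fin.sum_univ_succ] at hps
  have key := prod_sum_rpow_le_sum_prod_rpow (1 / p 0) (fun j : Fin k => 1 / p j.succ)
    (fun i => |x i 0| ^ (α * p 0)) (fun i j => |x i j.succ| ^ (α * p j.succ))
    (one_div_pos.2 (hp1 0 rfl).1) (fun j => (one_div_neg.2 (hp2 _ (hsucc j))).le) hps
    (fun i => Real.rpow_nonneg (abs_nonneg _) _)
    (fun i j => Real.rpow_pos_of_pos (abs_pos.2 (hx i _ (hsucc j))) _)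
  simpa only [hpow, Fin.prod_univ_succ] using key
end

section
/- Let n ≥ 1, let x_1, …, x_n and y_1, …, y_n be real numbers which are not all zero in each family (i.e. x_k ≠ 0 for some k and y_k ≠ 0 for some k), let 0 < α ≤ 1, and let r, p be real numbers with 0 < r < 1 < p. Then ((∑_{i=1}^n (|x_i|^α + |y_i|^α)^p) / (∑_{i=1}^n (|x_i|^α + |y_i|^α)^r))^(1/(p-r)) ≤ ((∑_{i=1}^n |x_i|^(αp)) / (∑_{i=1}^n |x_i|^(αr)))^(1/(p-r)) + ((∑_{i=1}^n |y_i|^(αp)) / (∑_{i=1}^n |y_i|^(αr)))^(1/(p-r)). -/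
/-- The reverse Minkowski inequality for finite sums and exponents in `(0, 1]`. -/
theorem add_rpow_le_sum_add_rpow {ι : Type*} (s : Finset ι) {a b : ι → ℝ} {r : ℝ}
    (hr : 0 < r) (hr1 : r ≤ 1) (ha : ∀ i ∈ s, 0 ≤ a i) (hb : ∀ i ∈ s, 0 ≤ b i)
    (hA : 0 < ∑ i ∈ s, a i ^ r) (hB : 0 < ∑ i ∈ s, b i ^ r) :
    ((∑ i ∈ s, a i ^ r) ^ (1 / r) + (∑ i ∈ s, b i ^ r) ^ (1 / r)) ^ r ≤
      ∑ i ∈ s, (a i + b i) ^ r := by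
  have hCr : ((∑ i ∈ s, a i ^ r) ^ (1 / r)) ^ r = ∑ i ∈ s, a i ^ r := by
    rw [one_div, Real.rpow_inv_rpow hA.le hr.ne']
  have hDr : ((∑ i ∈ s, b i ^ r) ^ (1 / r)) ^ r = ∑ i ∈ s, b i ^ r := by
    rw [one_div, Real.rpow_inv_rpow hB.le hr.ne']
  have hC := Real.rpow_pos_of_pos hA (1 / r)
  have hD := Real.rpow_pos_of_pos hB (1 / r)
  set C := (∑ i ∈ s, a i ^ r) ^ (1 / r)
  set D := (∑ i ∈ s, b i ^ r) ^ (1 / r)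
  have key : ∀ i ∈ s, (C + D) ^ r * (C / (C + D) * (a i ^ r / C ^ r) +
      D / (C + D) * (b i ^ r / D ^ r)) ≤ (a i + b i) ^ r := by
    intro i hi
    have hai := ha i hi
    have hbi := hb i hi
    have h := (Real.concaveOn_rpow hr.le hr1).2
      (Set.mem_Ici.2 (div_nonneg hai hC.le)) (Set.mem_Ici.2 (div_nonneg hbi hD.le))
      (div_pos hC (add_pos hC hD)).le (div_pos hD (add_pos hC hD)).le (by field_simp)
    simp only [smul_eq_mul] at h
    have h2 : C / (C + D) * (a i / C) + D / (C + D) * (b i / D) = (a i + b i) / (C + D) := by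
      field_simp
    rw [h2, Real.div_rpow hai hC.le, Real.div_rpow hbi hD.le,
      Real.div_rpow (add_nonneg hai hbi) (add_pos hC hD).le, le_div_iff₀ (by positivity)] at h
    linarith
  refine le_trans (le_of_eq ?_) (Finset.sum_le_sum key)
  rw [← Finset.mul_sum, Finset.sum_add_distrib, ← Finset.mul_sum, ← Finset.mul_sum,
    ← Finset.sum_div, ← Finset.sum_div, hCr, hDr, div_self hA.ne', div_self hB.ne']
  field_simp

/-- The function `(a, c) ↦ (a ^ p / c ^ r) ^ (1 / (p - r))` is subadditive. -/
theorem rpow_div_rpow_add_le {a b c d p r : ℝ} (ha : 0 ≤ a) (hb : 0 ≤ b) (hc : 0 < c)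
    (hd : 0 < d) (hr : 0 ≤ r) (hrp : r < p) :
    ((a + b) ^ p / (c + d) ^ r) ^ (1 / (p - r)) ≤
      (a ^ p / c ^ r) ^ (1 / (p - r)) + (b ^ p / d ^ r) ^ (1 / (p - r)) := by
  have hpr : 0 < p - r := sub_pos.2 hrp
  have hform : ∀ {u v : ℝ}, 0 ≤ u → 0 < v →
      (u ^ p / v ^ r) ^ (1 / (p - r)) = v * (u / v) ^ (p / (p - r)) := by
    intro u v hu hv
    have hsplit : u ^ p / v ^ r = v ^ (p - r) * (u / v) ^ p := by
      rw [Real.div_rpow hu hv.le, Real.rpow_sub hv]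
      field_simp
    rw [hsplit, Real.mul_rpow (by positivity) (by positivity), ← Real.rpow_mul hv.le,
      ← Real.rpow_mul (by positivity), mul_one_div_cancel hpr.ne', Real.rpow_one, mul_one_div]
  rw [hform (add_nonneg ha hb) (add_pos hc hd), hform ha hc, hform hb hd]
  have hs : 1 ≤ p / (p - r) := by
    rw [le_div_iff₀ hpr]
    linarith
  have h := (convexOn_rpow hs).2
    (Set.mem_Ici.2 (div_nonneg ha hc.le)) (Set.mem_Ici.2 (div_nonneg hb hd.le))
    (div_pos hc (add_pos hc hd)).le (div_pos hd (add_pos hc hd)).le (by field_simp)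
  simp only [smul_eq_mul] at h
  have h2 : c / (c + d) * (a / c) + d / (c + d) * (b / d) = (a + b) / (c + d) := by
    field_simp
  rw [h2] at h
  refine (mul_le_mul_of_nonneg_left h (add_pos hc hd).le).trans_eq ?_
  field_simp

/-- **Dresher's inequality** for finite sums of nonnegative reals. -/
theorem dresher_inequality {ι : Type*} (s : Finset ι) {a b : ι → ℝ} {r p : ℝ}
    (hr : 0 < r) (hr1 : r ≤ 1) (hp : 1 ≤ p) (hrp : r < p)
    (ha : ∀ i ∈ s, 0 ≤ a i) (hb : ∀ i ∈ s, 0 ≤ b i)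
    (hA : 0 < ∑ i ∈ s, a i ^ r) (hB : 0 < ∑ i ∈ s, b i ^ r) :
    ((∑ i ∈ s, (a i + b i) ^ p) / (∑ i ∈ s, (a i + b i) ^ r)) ^ (1 / (p - r)) ≤
      ((∑ i ∈ s, a i ^ p) / (∑ i ∈ s, a i ^ r)) ^ (1 / (p - r)) +
        ((∑ i ∈ s, b i ^ p) / (∑ i ∈ s, b i ^ r)) ^ (1 / (p - r)) := by
  have hp0 : 0 < p := one_pos.trans_le hp
  have hPa : 0 ≤ ∑ i ∈ s, a i ^ p := Finset.sum_nonneg fun i hi => Real.rpow_nonneg (ha i hi) p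
  have hPb : 0 ≤ ∑ i ∈ s, b i ^ p := Finset.sum_nonneg fun i hi => Real.rpow_nonneg (hb i hi) p
  have hPab : 0 ≤ ∑ i ∈ s, (a i + b i) ^ p :=
    Finset.sum_nonneg fun i hi => Real.rpow_nonneg (add_nonneg (ha i hi) (hb i hi)) p
  have hnum : ∑ i ∈ s, (a i + b i) ^ p ≤
      ((∑ i ∈ s, a i ^ p) ^ (1 / p) + (∑ i ∈ s, b i ^ p) ^ (1 / p)) ^ p := by
    have h := Real.rpow_le_rpow (by positivity) (Real.Lp_add_le_of_nonneg s hp ha hb) hp0.le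
    rwa [one_div, Real.rpow_inv_rpow hPab hp0.ne', ← one_div] at h
  have hden := add_rpow_le_sum_add_rpow s hr hr1 ha hb hA hB
  have h := rpow_div_rpow_add_le (Real.rpow_nonneg hPa (1 / p)) (Real.rpow_nonneg hPb (1 / p))
    (Real.rpow_pos_of_pos hA (1 / r)) (Real.rpow_pos_of_pos hB (1 / r)) hr.le hrp
  have hroot : ∀ {t q : ℝ}, 0 ≤ t → q ≠ 0 → (t ^ (1 / q)) ^ q = t := fun ht hq => by
    rw [one_div, Real.rpow_inv_rpow ht hq]
  rw [hroot hPa hp0.ne', hroot hPb hp0.ne', hroot hA.le hr.ne', hroot hB.le hr.ne'] at h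
  have hpos := Real.rpow_pos_of_pos
    (add_pos (Real.rpow_pos_of_pos hA (1 / r)) (Real.rpow_pos_of_pos hB (1 / r))) r
  refine le_trans (Real.rpow_le_rpow (div_nonneg hPab (hpos.trans_le hden).le) ?_
    (one_div_nonneg.2 (sub_pos.2 hrp).le)) h
  exact div_le_div₀ (by positivity) hnum hpos hden


theorem generalized_quotient_inequality (n : ℕ) (hn : 1 ≤ n) (x y : Fin n → ℝ)
    (hx : ∃ k, x k ≠ 0) (hy : ∃ k, y k ≠ 0) (α r p : ℝ)
    (hα0 : 0 < α) (hα1 : α ≤ 1) (hr : 0 < r) (hr1 : r < 1) (hp : 1 < p) :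
    ((∑ i, (|x i| ^ α + |y i| ^ α) ^ p) / (∑ i, (|x i| ^ α + |y i| ^ α) ^ r)) ^ (1 / (p - r)) ≤
      ((∑ i, |x i| ^ (α * p)) / (∑ i, |x i| ^ (α * r))) ^ (1 / (p - r)) +
        ((∑ i, |y i| ^ (α * p)) / (∑ i, |y i| ^ (α * r))) ^ (1 / (p - r)) := by
  have hpos : ∀ z : Fin n → ℝ, (∃ k, z k ≠ 0) → 0 < ∑ i, (|z i| ^ α) ^ r := by
    rintro z ⟨k, hk⟩
    exact Finset.sum_pos' (fun i _ => by positivity) ⟨k, Finset.mem_univ k, by positivity⟩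
  simp only [Real.rpow_mul (abs_nonneg _)]
  exact dresher_inequality Finset.univ hr hr1.le hp.le (hr1.trans hp)
    (fun i _ => by positivity) (fun i _ => by positivity) (hpos x hx) (hpos y hy)
end

section
/- Let n, m ≥ 1, let x_{ij} (1 ≤ i ≤ n, 1 ≤ j ≤ m) be real numbers such that for each j there exists i with x_{ij} ≠ 0, let 0 < α ≤ 1, and let r, p be real numbers with 0 < r < 1 < p. Then ((∑_{i=1}^n (∑_{j=1}^m |x_{ij}|^α)^p) / (∑_{i=1}^n (∑_{j=1}^m |x_{ij}|^α)^r))^(1/(p-r)) ≤ ∑_{j=1}^m ((∑_{i=1}^n |x_{ij}|^(αp)) / (∑_{i=1}^n |x_{ij}|^(αr)))^(1/(p-r)). -/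
/-- **Minkowski inequality** for a finite sum of functions with nonnegative values. -/
theorem Real.Lp_sum_le_of_nonneg {ι κ : Type*} (s : Finset ι) (t : Finset κ) (f : ι → κ → ℝ)
    (hf : ∀ i j, 0 ≤ f i j) {p : ℝ} (hp : 1 ≤ p) :
    (∑ i ∈ s, (∑ j ∈ t, f i j) ^ p) ^ (1 / p) ≤ ∑ j ∈ t, (∑ i ∈ s, f i j ^ p) ^ (1 / p) := by
  have hp0 : p ≠ 0 := by positivity
  classical
  induction t using Finset.induction_on with
  | empty => simp [Real.zero_rpow hp0, Real.zero_rpow (inv_ne_zero hp0)]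
  | insert k t hk ih =>
    simp only [Finset.sum_insert hk]
    exact (Real.Lp_add_le_of_nonneg s hp (fun i _ => hf i k)
      (fun i _ => Finset.sum_nonneg fun j _ => hf i j)).trans (by gcongr)

/-- **Reverse Minkowski inequality** for exponents in `(0, 1]`. -/
theorem Real.sum_Lp_le_of_nonneg {ι κ : Type*} (s : Finset ι) (t : Finset κ) (f : ι → κ → ℝ)
    (hf : ∀ i j, 0 ≤ f i j) {r : ℝ} (hr : 0 < r) (hr1 : r ≤ 1) :
    (∑ j ∈ t, (∑ i ∈ s, f i j ^ r) ^ (1 / r)) ^ r ≤ ∑ i ∈ s, (∑ j ∈ t, f i j) ^ r := by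
  have h := Real.Lp_sum_le_of_nonneg t s (fun j i => f i j ^ r)
    (fun j i => Real.rpow_nonneg (hf i j) r) (one_le_one_div hr hr1)
  have hrpow : ∀ i j, (f i j ^ r) ^ (1 / r) = f i j := fun i j => by
    rw [one_div, Real.rpow_rpow_inv (hf i j) hr.ne']
  simpa only [hrpow, one_div_one_div] using h

/-- **Radon's inequality**. -/
theorem Real.rpow_sum_div_rpow_sum_le {κ : Type*} (t : Finset κ) (ht : t.Nonempty) (u v : κ → ℝ)
    (hu : ∀ j, 0 ≤ u j) (hv : ∀ j, 0 < v j) {s : ℝ} (hs : 1 ≤ s) :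
    (∑ j ∈ t, u j) ^ s / (∑ j ∈ t, v j) ^ (s - 1) ≤ ∑ j ∈ t, u j ^ s / v j ^ (s - 1) := by
  have hs0 : 0 < s := by positivity
  have hV : 0 < ∑ j ∈ t, v j := Finset.sum_pos (fun j _ => hv j) ht
  have h := Real.inner_le_weight_mul_Lp_of_nonneg t hs v (fun j => u j / v j)
    (fun j => (hv j).le) (fun j => div_nonneg (hu j) (hv j).le)
  have h1 : ∀ j, v j * (u j / v j) = u j := fun j => mul_div_cancel₀ _ (hv j).ne'
  have h2 : ∀ j, v j * (u j / v j) ^ s = u j ^ s / v j ^ (s - 1) := fun j => by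
    have := hv j
    rw [Real.div_rpow (hu j) this.le, Real.rpow_sub_one this.ne']
    field_simp
  simp only [h1, h2] at h
  have hW : 0 ≤ ∑ j ∈ t, u j ^ s / v j ^ (s - 1) := Finset.sum_nonneg fun j _ =>
    div_nonneg (Real.rpow_nonneg (hu j) _) (Real.rpow_nonneg (hv j).le _)
  rw [div_le_iff₀' (by positivity)]
  refine (Real.rpow_le_rpow (Finset.sum_nonneg fun j _ => hu j) h hs0.le).trans_eq ?_
  rw [Real.mul_rpow (by positivity) (by positivity), ← Real.rpow_mul hV.le,
    Real.rpow_inv_rpow hW hs0.ne']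
  congr 2
  field_simp

/-- The **Beckenbach–Dresher inequality** for finite sums. -/
theorem Real.rpow_sum_div_sum_le {ι κ : Type*} (s : Finset ι) (t : Finset κ) (ht : t.Nonempty)
    (f : ι → κ → ℝ) (hf : ∀ i j, 0 ≤ f i j) (hpos : ∀ j, ∃ i ∈ s, 0 < f i j) {r p : ℝ}
    (hr : 0 < r) (hr1 : r < 1) (hp : 1 ≤ p) :
    ((∑ i ∈ s, (∑ j ∈ t, f i j) ^ p) / ∑ i ∈ s, (∑ j ∈ t, f i j) ^ r) ^ (1 / (p - r)) ≤
      ∑ j ∈ t, ((∑ i ∈ s, f i j ^ p) / ∑ i ∈ s, f i j ^ r) ^ (1 / (p - r)) := by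
  have hp0 : 0 < p := by positivity
  have hpr : 0 < p - r := by linarith
  have hS : ∀ i, 0 ≤ ∑ j ∈ t, f i j := fun i => Finset.sum_nonneg fun j _ => hf i j
  have hP : ∀ j, 0 ≤ ∑ i ∈ s, f i j ^ p := fun j =>
    Finset.sum_nonneg fun i _ => Real.rpow_nonneg (hf i j) p
  have hR : ∀ j, 0 < ∑ i ∈ s, f i j ^ r := fun j => by
    obtain ⟨i, hi, hij⟩ := hpos j
    exact Finset.sum_pos' (fun i _ => Real.rpow_nonneg (hf i j) r)
      ⟨i, hi, Real.rpow_pos_of_pos hij r⟩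
  set u : κ → ℝ := fun j => (∑ i ∈ s, f i j ^ p) ^ (1 / p) with hu_def
  set v : κ → ℝ := fun j => (∑ i ∈ s, f i j ^ r) ^ (1 / r) with hv_def
  have hu : ∀ j, 0 ≤ u j := fun j => Real.rpow_nonneg (hP j) _
  have hv : ∀ j, 0 < v j := fun j => Real.rpow_pos_of_pos (hR j) _
  have hU : 0 ≤ ∑ j ∈ t, u j := Finset.sum_nonneg fun j _ => hu j
  have hV : 0 < ∑ j ∈ t, v j := Finset.sum_pos (fun j _ => hv j) ht
  have hA0 : 0 ≤ ∑ i ∈ s, (∑ j ∈ t, f i j) ^ p :=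
    Finset.sum_nonneg fun i _ => Real.rpow_nonneg (hS i) p
  have hA : ∑ i ∈ s, (∑ j ∈ t, f i j) ^ p ≤ (∑ j ∈ t, u j) ^ p := by
    have h := Real.rpow_le_rpow (by positivity) (Real.Lp_sum_le_of_nonneg s t f hf hp) hp0.le
    rwa [one_div, Real.rpow_inv_rpow hA0 hp0.ne', ← one_div] at h
  have hB : (∑ j ∈ t, v j) ^ r ≤ ∑ i ∈ s, (∑ j ∈ t, f i j) ^ r :=
    Real.sum_Lp_le_of_nonneg s t f hf hr hr1.le
  have hexp : p * (1 / (p - r)) - 1 = r * (1 / (p - r)) := by field_simp; ring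
  have hquot : ∀ a b : ℝ, 0 ≤ a → 0 < b → (a ^ p / b ^ r) ^ (1 / (p - r)) =
      a ^ (p * (1 / (p - r))) / b ^ (p * (1 / (p - r)) - 1) := fun a b ha hb => by
    rw [Real.div_rpow (by positivity) (by positivity), ← Real.rpow_mul ha, ← Real.rpow_mul hb.le,
      hexp]
  have hs : 1 ≤ p * (1 / (p - r)) := by
    have : 0 < r * (1 / (p - r)) := by positivity
    linarith
  calc _ ≤ ((∑ j ∈ t, u j) ^ p / (∑ j ∈ t, v j) ^ r) ^ (1 / (p - r)) := by
        refine Real.rpow_le_rpow (div_nonneg hA0 (le_trans (by positivity) hB)) ?_ (by positivity)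
        gcongr
    _ ≤ ∑ j ∈ t, (u j ^ p / v j ^ r) ^ (1 / (p - r)) := by
        rw [hquot _ _ hU hV, Finset.sum_congr rfl fun j _ => hquot _ _ (hu j) (hv j)]
        exact Real.rpow_sum_div_rpow_sum_le t ht u v hu hv hs
    _ = _ := by
        refine Finset.sum_congr rfl fun j _ => ?_
        simp only [hu_def, hv_def, one_div]
        rw [Real.rpow_inv_rpow (hP j) hp0.ne', Real.rpow_inv_rpow (hR j).le hr.ne']

theorem generalized_quotient_inequality_m_summands (n m : ℕ) (hn : 1 ≤ n) (hm : 1 ≤ m)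
    (x : Fin n → Fin m → ℝ) (hx : ∀ j, ∃ i, x i j ≠ 0) (α r p : ℝ)
    (hα0 : 0 < α) (hα1 : α ≤ 1) (hr : 0 < r) (hr1 : r < 1) (hp : 1 < p) :
    ((∑ i, (∑ j, |x i j| ^ α) ^ p) / (∑ i, (∑ j, |x i j| ^ α) ^ r)) ^ (1 / (p - r)) ≤
      ∑ j, ((∑ i, |x i j| ^ (α * p)) / (∑ i, |x i j| ^ (α * r))) ^ (1 / (p - r)) := by
  have hne : (Finset.univ : Finset (Fin m)).Nonempty := ⟨⟨0, hm⟩, Finset.mem_univ _⟩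
  simp only [Real.rpow_mul (abs_nonneg _)]
  refine Real.rpow_sum_div_sum_le Finset.univ Finset.univ hne (fun i j => |x i j| ^ α)
    (fun i j => by positivity) (fun j => ?_) hr hr1 hp.le
  obtain ⟨i, hi⟩ := hx j
  exact ⟨i, Finset.mem_univ i, Real.rpow_pos_of_pos (abs_pos.2 hi) α⟩
end
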